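/- Let K be a field containing the parameters of BB_2 and work in BB_2(K). For t ∈ K define R(t) := −δt(t + qλ⁻¹)·1 + (t − 1)(t + qλ⁻¹)·X_1 + δt(t − 1)·e_1, and for t ∈ K with t² ≠ 1 define K(t) := (t²·q1/(1 − t²))·1 + Y. Then for all t1, t2 ∈ K with t2 ≠ 0 and t1² ≠ 1 ≠ t2², the reflection equation holds in BB_2(K): R(t1/t2)·K(t1)·R(t1·t2)·K(t2) = K(t2)·R(t1·t2)·K(t1)·R(t1/t2). Consequently, the same identity holds when K(t) is replaced by f1(t)·K(t) for any function f1 : K → K. -/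

import Mathlib

namespace BMWB

inductive Gen (n : ℕ) : Type
  | X : Fin (n - 1) → Gen n
  | Xinv : Fin (n - 1) → Gen n
  | Y : 0 < n → Gen n
  | Yinv : 0 < n → Gen n

variable (R : Type) [CommRing R]

def fX {n : ℕ} (i : Fin (n - 1)) : FreeAlgebra R (Gen n) := FreeAlgebra.ι R (Gen.X i)
def fXinv {n : ℕ} (i : Fin (n - 1)) : FreeAlgebra R (Gen n) := FreeAlgebra.ι R (Gen.Xinv i)
def fY {n : ℕ} (h : 0 < n) : FreeAlgebra R (Gen n) := FreeAlgebra.ι R (Gen.Y h)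
def fYinv {n : ℕ} (h : 0 < n) : FreeAlgebra R (Gen n) := FreeAlgebra.ι R (Gen.Yinv h)
def fe {n : ℕ} (deli : R) (i : Fin (n - 1)) : FreeAlgebra R (Gen n) :=
  1 - deli • (fX R i - fXinv R i)

variable (lam lami deli q0 q1 A : R) (n : ℕ)

/-- The defining relations of the reduced Birman-Murakami-Wenzl algebra of Coxeter type B. -/
inductive Rel : FreeAlgebra R (Gen n) → FreeAlgebra R (Gen n) → Prop
  | XXinv (i : Fin (n - 1)) : Rel (fX R i * fXinv R i) 1
  | XinvX (i : Fin (n - 1)) : Rel (fXinv R i * fX R i) 1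
  | YYinv (h : 0 < n) : Rel (fY R h * fYinv R h) 1
  | YinvY (h : 0 < n) : Rel (fYinv R h * fY R h) 1
  | comm (i j : Fin (n - 1)) (h : (j : ℕ) + 1 < (i : ℕ)) :
      Rel (fX R i * fX R j) (fX R j * fX R i)
  | braid (i j : Fin (n - 1)) (h : (i : ℕ) + 1 = (j : ℕ)) :
      Rel (fX R i * fX R j * fX R i) (fX R j * fX R i * fX R j)
  | Xe (i : Fin (n - 1)) : Rel (fX R i * fe R deli i) (lam • fe R deli i)
  | eX (i : Fin (n - 1)) : Rel (fe R deli i * fX R i) (lam • fe R deli i)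
  | eXe (i j : Fin (n - 1)) (h : (j : ℕ) + 1 = (i : ℕ)) :
      Rel (fe R deli i * fX R j * fe R deli i) (lami • fe R deli i)
  | eXinve (i j : Fin (n - 1)) (h : (j : ℕ) + 1 = (i : ℕ)) :
      Rel (fe R deli i * fXinv R j * fe R deli i) (lam • fe R deli i)
  | bYXYX (h : 0 < n) (i : Fin (n - 1)) (hi : (i : ℕ) = 0) :
      Rel (fX R i * fY R h * fX R i * fY R h) (fY R h * fX R i * fY R h * fX R i)
  | Ysq (h : 0 < n) : Rel (fY R h * fY R h) (q1 • fY R h + q0 • (1 : FreeAlgebra R (Gen n)))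
  | YXYe (h : 0 < n) (i : Fin (n - 1)) (hi : (i : ℕ) = 0) :
      Rel (fY R h * fX R i * fY R h * fe R deli i) (fe R deli i)
  | Ycomm (h : 0 < n) (i : Fin (n - 1)) (hi : 0 < (i : ℕ)) :
      Rel (fY R h * fX R i) (fX R i * fY R h)
  | eYe (h : 0 < n) (i : Fin (n - 1)) (hi : (i : ℕ) = 0) :
      Rel (fe R deli i * fY R h * fe R deli i) (A • fe R deli i)

/-- The reduced Birman-Murakami-Wenzl algebra of Coxeter type B, `BB_n(R)`,
presented by generators and relations. -/
abbrev BB : Type := RingQuot (Rel R lam lami deli q0 q1 A n)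

noncomputable def mk : FreeAlgebra R (Gen n) →ₐ[R] BB R lam lami deli q0 q1 A n :=
  RingQuot.mkAlgHom R (Rel R lam lami deli q0 q1 A n)

/-- The generator `Y` (junk value `1` if `n = 0`). -/
noncomputable def YY : BB R lam lami deli q0 q1 A n :=
  if h : 0 < n then mk R lam lami deli q0 q1 A n (fY R h) else 1

/-- The inverse of the generator `Y`. -/
noncomputable def YYi : BB R lam lami deli q0 q1 A n :=
  if h : 0 < n then mk R lam lami deli q0 q1 A n (fYinv R h) else 1

/-- The generator `X_i`, `1 ≤ i ≤ n-1` (junk value `1` out of range). -/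
noncomputable def XX (i : ℕ) : BB R lam lami deli q0 q1 A n :=
  if h : i - 1 < n - 1 then mk R lam lami deli q0 q1 A n (fX R ⟨i - 1, h⟩) else 1

/-- The inverse `X_i⁻¹`. -/
noncomputable def XXi (i : ℕ) : BB R lam lami deli q0 q1 A n :=
  if h : i - 1 < n - 1 then mk R lam lami deli q0 q1 A n (fXinv R ⟨i - 1, h⟩) else 1

/-- The element `e_i := 1 - δ⁻¹ (X_i - X_i⁻¹)`. -/
noncomputable def ee (i : ℕ) : BB R lam lami deli q0 q1 A n :=
  1 - deli • (XX R lam lami deli q0 q1 A n i - XXi R lam lami deli q0 q1 A n i)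

/-- `Y_i := X_{i-1} ⋯ X_1 Y X_1⁻¹ ⋯ X_{i-1}⁻¹`. -/
noncomputable def Yn : ℕ → BB R lam lami deli q0 q1 A n
  | 0 => 1
  | 1 => YY R lam lami deli q0 q1 A n
  | (k + 2) => XX R lam lami deli q0 q1 A n (k + 1) * Yn (k + 1) * XXi R lam lami deli q0 q1 A n (k + 1)

/-- `Y'_i := X_{i-1} ⋯ X_1 Y X_1 ⋯ X_{i-1}`. -/
noncomputable def Yp : ℕ → BB R lam lami deli q0 q1 A n
  | 0 => 1
  | 1 => YY R lam lami deli q0 q1 A n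
  | (k + 2) => XX R lam lami deli q0 q1 A n (k + 1) * Yp (k + 1) * XX R lam lami deli q0 q1 A n (k + 1)

/-- The inverse of `Y'_i`. -/
noncomputable def Ypi : ℕ → BB R lam lami deli q0 q1 A n
  | 0 => 1
  | 1 => YYi R lam lami deli q0 q1 A n
  | (k + 2) => XXi R lam lami deli q0 q1 A n (k + 1) * Ypi (k + 1) * XXi R lam lami deli q0 q1 A n (k + 1)

/-- The set of the images of the generators (and their inverses) of `BB_{m+1}` inside `BB_n`.
Its `Algebra.adjoin` is the image of the canonical algebra homomorphism `BB_{m+1} → BB_n`. -/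
noncomputable def genSet (m : ℕ) : Set (BB R lam lami deli q0 q1 A n) :=
  {a | a = YY R lam lami deli q0 q1 A n ∨ a = YYi R lam lami deli q0 q1 A n ∨
    ∃ i, 1 ≤ i ∧ i ≤ m ∧ (a = XX R lam lami deli q0 q1 A n i ∨ a = XXi R lam lami deli q0 q1 A n i)}

/-- The image of the canonical algebra homomorphism `BB_{m+1}(R) → BB_n(R)`, realized as the
subalgebra generated by the images of the generators `Y, Y⁻¹, X_1, …, X_m` (and inverses). -/
noncomputable def sub (m : ℕ) : Subalgebra R (BB R lam lami deli q0 q1 A n) :=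
  Algebra.adjoin R (genSet R lam lami deli q0 q1 A n m)

/-- `X(i,j) = X_i X_{i+1} ⋯ X_j`. -/
noncomputable def Xprod (i j : ℕ) : BB R lam lami deli q0 q1 A n :=
  ((List.range (j + 1 - i)).map (fun k => XX R lam lami deli q0 q1 A n (i + k))).prod

/-- `E(i,j) = e_i e_{i+2} ⋯ e_j`. -/
noncomputable def Eprod (i j : ℕ) : BB R lam lami deli q0 q1 A n :=
  ((List.range ((j - i) / 2 + 1)).map (fun k => ee R lam lami deli q0 q1 A n (i + 2 * k))).prod

/-- `H_1 = e_1`, `H_{m+1} = e_{m+1} X(m+2, 2m+1) X(m+1, 2m) H_m`. -/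
noncomputable def H : ℕ → BB R lam lami deli q0 q1 A n
  | 0 => 1
  | 1 => ee R lam lami deli q0 q1 A n 1
  | (k + 2) => ee R lam lami deli q0 q1 A n (k + 2) *
      Xprod R lam lami deli q0 q1 A n (k + 3) (2 * k + 3) *
      Xprod R lam lami deli q0 q1 A n (k + 2) (2 * k + 2) * H (k + 1)

/-- The Baxterized solution `R(t)` of the Yang–Baxter equation, as an element of `BB_2(K)`. -/
noncomputable def RMat (K : Type) [Field K] (q lam del q0 q1 A : K) (t : K) :
    BB K lam lam⁻¹ del⁻¹ q0 q1 A 2 :=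
  (-(del * t * (t + q * lam⁻¹))) • (1 : BB K lam lam⁻¹ del⁻¹ q0 q1 A 2) +
    ((t - 1) * (t + q * lam⁻¹)) • XX K lam lam⁻¹ del⁻¹ q0 q1 A 2 1 +
    (del * t * (t - 1)) • ee K lam lam⁻¹ del⁻¹ q0 q1 A 2 1

/-- The boundary reflection matrix `K(t) = (t² q1/(1 − t²)) + Y` in `BB_2(K)`. -/
noncomputable def KMat (K : Type) [Field K] (lam del q0 q1 A : K) (t : K) :
    BB K lam lam⁻¹ del⁻¹ q0 q1 A 2 :=
  (t ^ 2 * q1 / (1 - t ^ 2)) • (1 : BB K lam lam⁻¹ del⁻¹ q0 q1 A 2) + YY K lam lam⁻¹ del⁻¹ q0 q1 A 2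

section ReflectionEquation

variable {K B : Type*} [Field K] [Ring B] [Algebra K B]

theorem reflection_commutator {X Y e : B} {q lam del q0 q1 A x : K}
    (hX2 : X * X = 1 + del • X - (del * lam) • e)
    (hXe : X * e = lam • e) (heX : e * X = lam • e) (hee : e * e = x • e)
    (hY2 : Y * Y = q1 • Y + q0 • 1)
    (hbraid : X * Y * X * Y = Y * X * Y * X)
    (hYXYe : Y * X * Y * e = e) (hqq0 : q * q0 = 1) (heYe : e * Y * e = A • e)
    (hXYe : X * Y * e = q • (Y * e) - (q * q1) • e)
    (heYX : e * Y * X = q • (e * Y) - (q * q1) • e)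
    (a b c a' b' c' k₁ k₂ : K) :
    (a • 1 + b • X + c • e) * (k₁ • 1 + Y) * (a' • 1 + b' • X + c' • e) * (k₂ • 1 + Y) -
      (k₂ • 1 + Y) * (a' • 1 + b' • X + c' • e) * (k₁ • 1 + Y) * (a • 1 + b • X + c • e) =
    (a * (k₁ - k₂) * b' + a' * (k₁ + k₂ + q1) * b + k₁ * b * b' * del) • (X * Y - Y * X) +
    (a * (k₁ - k₂) * c' + a' * (k₁ + k₂ + q1) * c +
      k₁ * (-(b * b' * del * lam) + (b * c' + b' * c) * lam + c * c' * x) -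
      k₂ * q * (b * c' - c * b') - q * q1 * b * c' + A * c * c') • (e * Y - Y * e) := by
  have hYXX : Y * X * X = Y + del • (Y * X) - (del * lam) • (Y * e) := by
    rw [mul_assoc, hX2]; simp [mul_add, mul_sub]
  have hYXe : Y * X * e = lam • (Y * e) := by rw [mul_assoc, hXe, mul_smul_comm]
  have hYeX : Y * e * X = lam • (Y * e) := by rw [mul_assoc, heX, mul_smul_comm]
  have hYee : Y * e * e = x • (Y * e) := by rw [mul_assoc, hee, mul_smul_comm]
  have hXYY : X * Y * Y = q1 • (X * Y) + q0 • X := by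
    rw [mul_assoc, hY2]; simp [mul_add]
  have heYY : e * Y * Y = q1 • (e * Y) + q0 • e := by
    rw [mul_assoc, hY2]; simp [mul_add]
  have hYYX : Y * Y * X = q1 • (Y * X) + q0 • X := by rw [hY2]; simp [add_mul]
  have hYYe : Y * Y * e = q1 • (Y * e) + q0 • e := by rw [hY2]; simp [add_mul]
  have hYeYX : Y * e * Y * X = q • (Y * e * Y) - (q * q1) • (Y * e) := by
    rw [mul_assoc Y e Y, mul_assoc Y (e * Y) X, heYX]; simp [mul_sub]
  have hYeYe : Y * e * Y * e = A • (Y * e) := by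
    rw [mul_assoc Y e Y, mul_assoc Y (e * Y) e, heYe, mul_smul_comm]
  have hqe : (q * q0) • e = e := by rw [hqq0, one_smul]
  simp only [add_mul, mul_add, smul_mul_assoc, mul_smul_comm, one_mul, mul_one, ← mul_assoc,
    hYXX, hYXe, hYeX, hYee, hXYY, heYY, hYYX, hYYe, hYeYX, hYeYe, hYXYe, hbraid,
    hXYe, heYX, heYe, hX2, hXe, heX, hee, sub_mul]
  linear_combination (norm := module) (c * b') • hqe

theorem reflection_equation_of_relations {X Xi Y Yi e : B} {q lam del q0 q1 A x : K}
    (hqne : q ≠ 0) (hlamne : lam ≠ 0) (hdelne : del ≠ 0)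
    (hq0 : q0 = q⁻¹) (hdelta : del = q - q⁻¹) (hx : x * del = del - lam + lam⁻¹)
    (he : e = 1 - del⁻¹ • (X - Xi)) (hXXi : X * Xi = 1) (hXiX : Xi * X = 1)
    (hYiY : Yi * Y = 1) (hYYi : Y * Yi = 1)
    (hXe : X * e = lam • e) (heX : e * X = lam • e)
    (hY2 : Y * Y = q1 • Y + q0 • 1)
    (hbraid : X * Y * X * Y = Y * X * Y * X)
    (hYXYe : Y * X * Y * e = e) (heYe : e * Y * e = A • e)
    {t₁ t₂ : K} (ht₂ : t₂ ≠ 0) (ht₁' : t₁ ^ 2 ≠ 1) (ht₂' : t₂ ^ 2 ≠ 1)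
    {R S : K → B}
    (hR : ∀ t, R t = (-(del * t * (t + q * lam⁻¹))) • (1 : B) +
      ((t - 1) * (t + q * lam⁻¹)) • X + (del * t * (t - 1)) • e)
    (hS : ∀ t, S t = (t ^ 2 * q1 / (1 - t ^ 2)) • (1 : B) + Y) :
    R (t₁ / t₂) * S t₁ * R (t₁ * t₂) * S t₂ = S t₂ * R (t₁ * t₂) * S t₁ * R (t₁ / t₂) := by
  have hqq0 : q * q0 = 1 := by rw [hq0, mul_inv_cancel₀ hqne]
  have hXi : Xi = X - del • (1 - e) := by
    rw [he, sub_sub_cancel, smul_smul, mul_inv_cancel₀ hdelne, one_smul, sub_sub_cancel]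
  have hX2 : X * X = 1 + del • X - (del * lam) • e := by
    have h := hXXi
    rw [hXi, mul_sub, mul_smul_comm, mul_sub, mul_one, hXe] at h
    linear_combination (norm := module) h
  have hee : e * e = x • e := by
    have hXie : Xi * e = lam⁻¹ • e := by
      have h : Xi * (X * e) = e := by rw [← mul_assoc, hXiX, one_mul]
      rw [hXe, mul_smul_comm] at h
      rw [eq_inv_smul_iff₀ hlamne, h]
    rw [hXi, sub_mul, smul_mul_assoc, sub_mul, one_mul, hXe] at hXie
    have h : del • (e * e) = (x * del) • e := by
      rw [hx]; linear_combination (norm := module) hXie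
    rw [mul_comm, mul_smul] at h
    exact smul_right_injective B hdelne h
  have hYi : Yi = q • Y - (q * q1) • 1 := by
    have h : Y * (q • Y - (q * q1) • (1 : B)) = 1 := by
      rw [mul_sub, mul_smul_comm, mul_smul_comm, hY2, mul_one, smul_add, smul_smul, smul_smul,
        hqq0]
      module
    exact left_inv_eq_right_inv hYiY h
  have hcomm : Commute (Y * X * Y) e := by
    have hX : Commute (Y * X * Y) X := by
      rw [Commute, SemiconjBy, ← hbraid]; simp only [mul_assoc]
    have hXi' : Commute (Y * X * Y) Xi := by
      calc Y * X * Y * Xi = Xi * X * (Y * X * Y) * Xi := by rw [hXiX, one_mul]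
        _ = Xi * (X * (Y * X * Y)) * Xi := by rw [mul_assoc Xi X]
        _ = Xi * (Y * X * Y) * (X * Xi) := by rw [← hX.eq]; simp only [mul_assoc]
        _ = Xi * (Y * X * Y) := by rw [hXXi, mul_one]
    rw [he]
    exact (Commute.one_right _).sub_right ((hX.sub_right hXi').smul_right _)
  have heYXY' : e * (Y * X * Y) = e := by rw [← hcomm.eq, hYXYe]
  have hXYe : X * Y * e = q • (Y * e) - (q * q1) • e := by
    calc X * Y * e = Yi * Y * (X * Y * e) := by rw [hYiY, one_mul]
      _ = Yi * (Y * X * Y * e) := by simp only [mul_assoc]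
      _ = q • (Y * e) - (q * q1) • e := by
        rw [hYXYe, hYi, sub_mul, smul_mul_assoc, smul_mul_assoc, one_mul]
  have heYX : e * Y * X = q • (e * Y) - (q * q1) • e := by
    calc e * Y * X = e * Y * X * (Y * Yi) := by rw [hYYi, mul_one]
      _ = e * (Y * X * Y) * Yi := by simp only [mul_assoc]
      _ = q • (e * Y) - (q * q1) • e := by
        rw [heYXY', hYi, mul_sub, mul_smul_comm, mul_smul_comm, mul_one]
  -- Reducing `X * X * Y * e` in two ways determines `A` on the ideal generated by `e`.
  have hAe : (del * lam * A - q1 * (1 + q * lam)) • e = 0 := by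
    have h₁ : X * (X * Y * e) = q • (X * Y * e) - (q * q1 * lam) • e := by
      rw [hXYe, mul_sub, mul_smul_comm, mul_smul_comm, hXe, ← mul_assoc, hXYe, smul_smul]
    have h₂ : X * (X * Y * e) = Y * e + del • (X * Y * e) - (del * lam) • (A • e) := by
      rw [← heYe, mul_assoc X Y e, ← mul_assoc, hX2]
      simp only [add_mul, sub_mul, one_mul, smul_mul_assoc, mul_assoc]
    rw [h₁, hXYe] at h₂
    have hqd : q * del = q * q - 1 := by rw [hdelta]; field_simp
    linear_combination (norm := skip) h₂
    match_scalars
    · linear_combination -q1 * hqd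
    · linear_combination hqd
  have hd₁ : 1 - t₁ ^ 2 ≠ 0 := sub_ne_zero.mpr ht₁'.symm
  have hd₂ : 1 - t₂ ^ 2 ≠ 0 := sub_ne_zero.mpr ht₂'.symm
  have hx' : x = (del - lam + lam⁻¹) / del := by rw [← hx, mul_div_cancel_right₀ _ hdelne]
  rw [← sub_eq_zero]
  simp only [hR, hS]
  rw [reflection_commutator hX2 hXe heX hee hY2 hbraid hYXYe
    hqq0 heYe hXYe heYX]
  set c := del * (t₁ / t₂) * (t₁ / t₂ - 1) with hc
  set c' := del * (t₁ * t₂) * (t₁ * t₂ - 1) with hc'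
  have hAQ : (del * lam * A - q1 * (1 + q * lam)) • (e * Y - Y * e) = 0 := by
    rw [smul_sub, ← smul_mul_assoc, ← mul_smul_comm, hAe, zero_mul, mul_zero, sub_zero]
  linear_combination (norm := skip) ((del * lam)⁻¹ * c * c') • hAQ
  match_scalars
  all_goals
    simp only [hc, hc', hx', hdelta] at hdelne ⊢
  all_goals
    have hq2 : q ^ 2 - 1 ≠ 0 := by
      intro h
      apply hdelne
      field_simp
      rw [h, mul_zero]
    field_simp
    ring

end ReflectionEquation

/-- Proposition 30: `K(t) = (t² q1 (1−t²)⁻¹ + Y) f1(t)` solves Sklyanin's reflection equation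
in `BB_2(K)`. -/
theorem BB_reflection_equation (K : Type) [Field K] [IsDomain K]
    (q lam del q0 q1 A x : K)
    (hqne : q ≠ 0) (hlamne : lam ≠ 0) (hdelne : del ≠ 0)
    (hq0 : q0 = q⁻¹) (hdelta : del = q - q⁻¹) (hx : x * del = del - lam + lam⁻¹)
    (hA : A * (1 - q0 * lam) = q1 * x) :
    ∀ t1 t2 : K, t2 ≠ 0 → t1 ^ 2 ≠ 1 → t2 ^ 2 ≠ 1 →
      (RMat K q lam del q0 q1 A (t1 / t2) * KMat K lam del q0 q1 A t1 *
          RMat K q lam del q0 q1 A (t1 * t2) * KMat K lam del q0 q1 A t2 =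
        KMat K lam del q0 q1 A t2 * RMat K q lam del q0 q1 A (t1 * t2) *
          KMat K lam del q0 q1 A t1 * RMat K q lam del q0 q1 A (t1 / t2)) ∧
      (∀ f1 : K → K,
        RMat K q lam del q0 q1 A (t1 / t2) * (f1 t1 • KMat K lam del q0 q1 A t1) *
            RMat K q lam del q0 q1 A (t1 * t2) * (f1 t2 • KMat K lam del q0 q1 A t2) =
          (f1 t2 • KMat K lam del q0 q1 A t2) * RMat K q lam del q0 q1 A (t1 * t2) *
            (f1 t1 • KMat K lam del q0 q1 A t1) * RMat K q lam del q0 q1 A (t1 / t2)) := by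
  intro t1 t2 ht2 ht1' ht2'
  have h0 : 0 < 2 := Nat.two_pos
  have h1 : 1 - 1 < 2 - 1 := Nat.one_pos
  have hYY : YY K lam lam⁻¹ del⁻¹ q0 q1 A 2 = mk K lam lam⁻¹ del⁻¹ q0 q1 A 2 (fY K h0) :=
    dif_pos h0
  have hXX : XX K lam lam⁻¹ del⁻¹ q0 q1 A 2 1 =
      mk K lam lam⁻¹ del⁻¹ q0 q1 A 2 (fX K ⟨1 - 1, h1⟩) := dif_pos h1
  have hXXi : XXi K lam lam⁻¹ del⁻¹ q0 q1 A 2 1 =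
      mk K lam lam⁻¹ del⁻¹ q0 q1 A 2 (fXinv K ⟨1 - 1, h1⟩) := dif_pos h1
  have hee : ee K lam lam⁻¹ del⁻¹ q0 q1 A 2 1 =
      mk K lam lam⁻¹ del⁻¹ q0 q1 A 2 (fe K del⁻¹ ⟨1 - 1, h1⟩) := by
    rw [ee, hXX, hXXi, fe, map_sub, map_smul, map_sub, map_one]
  have hrel {u v : FreeAlgebra K (Gen 2)} (h : Rel K lam lam⁻¹ del⁻¹ q0 q1 A 2 u v) :
      mk K lam lam⁻¹ del⁻¹ q0 q1 A 2 u = mk K lam lam⁻¹ del⁻¹ q0 q1 A 2 v :=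
    RingQuot.mkAlgHom_rel K h
  have key := reflection_equation_of_relations (X := XX K lam lam⁻¹ del⁻¹ q0 q1 A 2 1)
    (Xi := XXi K lam lam⁻¹ del⁻¹ q0 q1 A 2 1) (Y := YY K lam lam⁻¹ del⁻¹ q0 q1 A 2)
    (Yi := mk K lam lam⁻¹ del⁻¹ q0 q1 A 2 (fYinv K h0))
    (e := ee K lam lam⁻¹ del⁻¹ q0 q1 A 2 1)
    hqne hlamne hdelne hq0 hdelta hx rfl
    (by rw [hXX, hXXi]; simpa using hrel (.XXinv ⟨1 - 1, h1⟩))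
    (by rw [hXX, hXXi]; simpa using hrel (.XinvX ⟨1 - 1, h1⟩))
    (by rw [hYY]; simpa using hrel (.YinvY h0))
    (by rw [hYY]; simpa using hrel (.YYinv h0))
    (by rw [hXX, hee]; simpa using hrel (.Xe ⟨1 - 1, h1⟩))
    (by rw [hXX, hee]; simpa using hrel (.eX ⟨1 - 1, h1⟩))
    (by rw [hYY]; simpa using hrel (.Ysq h0))
    (by rw [hXX, hYY]; simpa using hrel (.bYXYX h0 ⟨1 - 1, h1⟩ rfl))
    (by rw [hXX, hYY, hee]; simpa using hrel (.YXYe h0 ⟨1 - 1, h1⟩ rfl))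
    (by rw [hYY, hee]; simpa using hrel (.eYe h0 ⟨1 - 1, h1⟩ rfl))
    ht2 ht1' ht2' (R := RMat K q lam del q0 q1 A) (S := KMat K lam del q0 q1 A)
    (fun _ => rfl) (fun _ => rfl)
  refine ⟨key, fun f1 => ?_⟩
  simp only [mul_smul_comm, smul_mul_assoc, key, smul_comm (f1 t1) (f1 t2)]

end BMWB
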